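/- For every nonzero real number a, with b = min(a, ln 2), one has ∫_0^{π/2} ln(x² + ln²(2 e^{−a} cos x)) · cos(2x) dx = (π/2) · (1 − 1/a − e^b + 1/(e^b − 1)). -/

import Mathlib

open Real

lemma aux_log_eq (a x : ℝ) (hx : 0 < cos x) :
    Real.log (2 * Real.exp (-a) * Real.cos x) = Real.log (cos x) + (Real.log 2 - a) := by
  rw [Real.log_mul (by positivity) hx.ne', Real.log_mul (by positivity) (by positivity), Real.log_exp]
  ring

lemma aux_bound (x L : ℝ) (hx : 0 < x) :
    |Real.log (x ^ 2 + L ^ 2)| ≤ 2 * (|Real.log x| + x + |L|) := by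
  have h1 : Real.log (x ^ 2) ≤ Real.log (x ^ 2 + L ^ 2) :=
    Real.log_le_log (by positivity) (by nlinarith [sq_nonneg L])
  have h2 : Real.log (x ^ 2 + L ^ 2) ≤ Real.log ((x + |L|) ^ 2) := by
    apply Real.log_le_log (by positivity)
    nlinarith [sq_abs L, abs_nonneg L, mul_nonneg hx.le (abs_nonneg L)]
  rw [Real.log_pow] at h1 h2
  push_cast at h1 h2
  have h3 : Real.log (x + |L|) ≤ x + |L| - 1 := Real.log_le_sub_one_of_pos (by positivity)
  rw [abs_le]
  have := neg_abs_le (Real.log x)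
  have := abs_nonneg (Real.log x)
  have := abs_nonneg L
  constructor <;> linarith

lemma aux_integrable (a : ℝ) : IntervalIntegrable (fun x : ℝ =>
    Real.log (x ^ 2 + Real.log (2 * Real.exp (-a) * Real.cos x) ^ 2) * Real.cos (2 * x))
    MeasureTheory.volume 0 (π / 2) := by
  have hB : IntervalIntegrable (fun x : ℝ =>
      2 * (|Real.log x| + x + (|Real.log (cos x)| + |Real.log 2 - a|)))
      MeasureTheory.volume 0 (π / 2) := by
    apply IntervalIntegrable.const_mul
    refine ((intervalIntegral.intervalIntegrable_log'.abs).add (continuous_id.intervalIntegrable _ _)).add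
      (IntervalIntegrable.add ?_ intervalIntegrable_const)
    exact (intervalIntegrable_log_cos (a := 0) (b := π / 2)).abs
  refine hB.mono_fun ?_ ?_
  · apply Measurable.aestronglyMeasurable
    fun_prop
  · rw [Set.uIoc_of_le (by positivity), ← MeasureTheory.Measure.restrict_congr_set MeasureTheory.Ioo_ae_eq_Ioc]
    filter_upwards [MeasureTheory.ae_restrict_mem measurableSet_Ioo] with x hx
    have hc : 0 < cos x := Real.cos_pos_of_mem_Ioo ⟨by linarith [hx.1, Real.pi_pos], hx.2⟩
    rw [aux_log_eq a x hc, Real.norm_eq_abs, Real.norm_eq_abs, abs_mul]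
    have h1 := aux_bound x (Real.log (cos x) + (Real.log 2 - a)) hx.1
    have h2 := abs_add_le (Real.log (cos x)) (Real.log 2 - a)
    have h3 := Real.abs_cos_le_one (2 * x)
    calc _ ≤ |Real.log (x ^ 2 + (Real.log (cos x) + (Real.log 2 - a)) ^ 2)| * 1 := by gcongr
      _ ≤ 2 * (|Real.log x| + x + (|Real.log (cos x)| + |Real.log 2 - a|)) := by linarith
      _ ≤ _ := le_abs_self _

lemma aux_cont (a : ℝ) : ContinuousOn (fun x : ℝ => Real.sin (2 * x) / 2 *
    Real.log (x ^ 2 + Real.log (2 * Real.exp (-a) * Real.cos x) ^ 2)) (Set.Icc 0 (π / 2)) := by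
  have hpi := Real.pi_pos
  have key : ∀ x ∈ Set.Ioo 0 (π / 2), ‖Real.sin (2 * x) / 2 *
      Real.log (x ^ 2 + Real.log (2 * Real.exp (-a) * Real.cos x) ^ 2)‖ ≤
      |Real.sin (2 * x)| * (|Real.log x| + x + (|Real.log (cos x)| + |Real.log 2 - a|)) := by
    intro x hx
    have hc : 0 < cos x := Real.cos_pos_of_mem_Ioo ⟨by linarith [hx.1, Real.pi_pos], hx.2⟩
    rw [aux_log_eq a x hc, Real.norm_eq_abs, abs_mul, abs_div, abs_of_pos (zero_lt_two' ℝ)]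
    have h1 := aux_bound x (Real.log (cos x) + (Real.log 2 - a)) hx.1
    have h2 := abs_add_le (Real.log (cos x)) (Real.log 2 - a)
    calc _ ≤ |Real.sin (2 * x)| / 2 * (2 * (|Real.log x| + x + (|Real.log (cos x)| + |Real.log 2 - a|))) := by
          gcongr; linarith
      _ = _ := by ring
  intro x hx
  rcases eq_or_lt_of_le hx.1 with h0 | h0
  · subst h0
    -- at 0
    unfold ContinuousWithinAt
    simp only [mul_zero, Real.sin_zero, zero_div, zero_mul]
    have hcont : Filter.Tendsto (fun x : ℝ => 2 * |x * Real.log x| +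
        |Real.sin (2 * x)| * (x + (|Real.log (cos x)| + |Real.log 2 - a|))) (nhdsWithin 0 (Set.Icc 0 (π/2))) (nhds 0) := by
      have : ContinuousAt (fun x : ℝ => 2 * |x * Real.log x| +
        |Real.sin (2 * x)| * (x + (|Real.log (cos x)| + |Real.log 2 - a|))) 0 := by
        have h1 : ContinuousAt (fun x : ℝ => x * Real.log x) 0 := Real.continuous_mul_log.continuousAt
        have h2 : ContinuousAt (fun x : ℝ => Real.log (cos x)) 0 :=
          Real.continuous_cos.continuousAt.log (by simp)
        fun_prop
      have h := this.tendsto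
      simp only [mul_zero, Real.sin_zero, zero_mul, abs_zero, add_zero] at h
      exact h.mono_left nhdsWithin_le_nhds
    refine squeeze_zero_norm' ?_ hcont
    have hlt : ∀ᶠ x : ℝ in nhdsWithin 0 (Set.Icc 0 (π/2)), x < π / 2 :=
      nhdsWithin_le_nhds (Iio_mem_nhds (by positivity))
    filter_upwards [self_mem_nhdsWithin, hlt] with x hx hx2
    rcases eq_or_lt_of_le hx.1 with h0 | h0
    · subst h0; simp
    · refine (key x ⟨h0, hx2⟩).trans ?_
      have hs : |Real.sin (2 * x)| ≤ 2 * x := by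
        have := Real.abs_sin_le_abs (x := 2 * x)
        rwa [abs_of_pos (by positivity : 0 < 2 * x)] at this
      rw [abs_mul x, abs_of_pos h0]
      have := mul_le_mul_of_nonneg_right hs (abs_nonneg (Real.log x))
      linarith
  rcases eq_or_lt_of_le hx.2 with h1 | h1
  · subst h1
    unfold ContinuousWithinAt
    have e : (2 * (π / 2)) = π := by ring
    simp only [e, Real.sin_pi, zero_div, zero_mul]
    have hcont : Filter.Tendsto (fun x : ℝ => 2 * |cos x * Real.log (cos x)| +
        |Real.sin (2 * x)| * (|Real.log x| + x + (|Real.log 2 - a|))) (nhdsWithin (π/2) (Set.Icc 0 (π/2))) (nhds 0) := by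
      have : ContinuousAt (fun x : ℝ => 2 * |cos x * Real.log (cos x)| +
        |Real.sin (2 * x)| * (|Real.log x| + x + (|Real.log 2 - a|))) (π / 2) := by
        have h1 : ContinuousAt (fun x : ℝ => cos x * Real.log (cos x)) (π / 2) :=
          (Real.continuous_mul_log.comp Real.continuous_cos).continuousAt
        have h2 : ContinuousAt (fun x : ℝ => Real.log x) (π / 2) :=
          Real.continuousAt_log (by positivity)
        fun_prop
      have h := this.tendsto
      simp only [e, Real.cos_pi_div_two, mul_zero, Real.sin_pi, zero_mul, abs_zero, add_zero] at h
      exact h.mono_left nhdsWithin_le_nhds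
    refine squeeze_zero_norm' ?_ hcont
    have hlt : ∀ᶠ x : ℝ in nhdsWithin (π / 2) (Set.Icc 0 (π/2)), 0 < x :=
      nhdsWithin_le_nhds (Ioi_mem_nhds (by positivity))
    filter_upwards [self_mem_nhdsWithin, hlt] with x hx hx2
    rcases eq_or_lt_of_le hx.2 with h0 | h0
    · subst h0; simp [e]
    · refine (key x ⟨hx2, h0⟩).trans ?_
      have hc : 0 < cos x := Real.cos_pos_of_mem_Ioo ⟨by linarith [hx2], h0⟩
      have hs : |Real.sin (2 * x)| ≤ 2 * cos x := by
        rw [Real.sin_two_mul, abs_mul, abs_mul, abs_of_pos hc, abs_of_pos (zero_lt_two' ℝ)]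
        have := Real.abs_sin_le_one x
        nlinarith
      rw [abs_mul (cos x), abs_of_pos hc]
      have := mul_le_mul_of_nonneg_right hs (abs_nonneg (Real.log (cos x)))
      linarith
  · have hc : 0 < cos x := Real.cos_pos_of_mem_Ioo ⟨by linarith [h0], h1⟩
    have : ContinuousAt (fun x : ℝ => Real.log (2 * Real.exp (-a) * Real.cos x)) x :=
      ContinuousAt.log (by fun_prop) (by positivity)
    apply ContinuousAt.continuousWithinAt
    apply ContinuousAt.mul (by fun_prop)
    exact ContinuousAt.log (by fun_prop) (by positivity)

lemma aux_parts (a : ℝ) (r : ℝ → ℝ) (hr : Continuous r)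
    (h : ∀ x ∈ Set.Ioo 0 (π / 2), r x =
      ((cos (2 * x) - 1) * (Real.log (2 * Real.exp (-a) * Real.cos x)) + x * sin (2 * x)) /
        (x ^ 2 + Real.log (2 * Real.exp (-a) * Real.cos x) ^ 2)) :
    ∫ x in (0:ℝ)..(π/2),
        Real.log (x ^ 2 + Real.log (2 * Real.exp (-a) * Real.cos x) ^ 2) *
          Real.cos (2 * x) = - ∫ x in (0:ℝ)..(π/2), r x := by
  have hpi := Real.pi_pos
  have hri : IntervalIntegrable r MeasureTheory.volume 0 (π / 2) := hr.intervalIntegrable _ _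
  have := intervalIntegral.integral_eq_sub_of_hasDerivAt_of_le (by positivity) (aux_cont a)
    (f' := fun x => Real.log (x ^ 2 + Real.log (2 * Real.exp (-a) * Real.cos x) ^ 2) *
          Real.cos (2 * x) + r x) ?_ ((aux_integrable a).add hri)
  · rw [intervalIntegral.integral_add (aux_integrable a) hri] at this
    have e : (2 * (π / 2)) = π := by ring
    simp [e] at this
    linarith
  · intro x hx
    have hc : 0 < cos x := Real.cos_pos_of_mem_Ioo ⟨by linarith [hx.1], hx.2⟩
    have hx0 := hx.1
    rw [h x hx]
    have d1 : HasDerivAt (fun x : ℝ => 2 * Real.exp (-a) * Real.cos x) (2 * Real.exp (-a) * (- Real.sin x)) x :=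
      (Real.hasDerivAt_cos x).const_mul _
    have d2 := d1.log (by positivity)
    have d3 := ((hasDerivAt_pow 2 x).add (d2.pow 2)).log (by simp only [Pi.add_apply, Pi.pow_apply]; positivity)
    have d4 : HasDerivAt (fun x : ℝ => Real.sin (2 * x) / 2) (cos (2 * x)) x := by
      have := ((hasDerivAt_id x).const_mul 2).sin.div_const 2
      simpa using this
    refine (d4.mul d3).congr_deriv ?_
    simp only [Pi.add_apply, Pi.pow_apply]
    have hE := Real.exp_pos (-a)
    have hD : 0 < x ^ 2 + Real.log (2 * Real.exp (-a) * Real.cos x) ^ 2 := by positivity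
    set L := Real.log (2 * Real.exp (-a) * Real.cos x)
    rw [Real.sin_two_mul, Real.cos_two_mul]
    have hs := Real.sin_sq x
    field_simp
    simp only [Nat.cast_ofNat]
    ring_nf
    rw [hs]
    ring

lemma aux_clog (x : ℝ) (h1 : -(π / 2) < x) (h2 : x < π / 2) :
    Complex.log (1 + circleMap 0 1 (2 * x)) = ((Real.log (cos x) + Real.log 2 : ℝ) : ℂ) + x * Complex.I := by
  have hpi := Real.pi_pos
  have hc : 0 < cos x := Real.cos_pos_of_mem_Ioo ⟨h1, h2⟩
  have e : 1 + circleMap 0 1 (2 * x) = Complex.exp (((Real.log (cos x) + Real.log 2 : ℝ) : ℂ) + x * Complex.I) := by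
    rw [Complex.exp_add, ← Complex.ofReal_exp, Real.exp_add, Real.exp_log hc, Real.exp_log two_pos]
    rw [circleMap_zero, Complex.exp_mul_I, Complex.exp_mul_I]
    push_cast
    rw [Complex.cos_two_mul, Complex.sin_two_mul]
    ring
  rw [e, Complex.log_exp]
  · rw [Complex.add_im, Complex.ofReal_im]; simp; linarith
  · rw [Complex.add_im, Complex.ofReal_im]; simp; linarith

lemma aux_re (a x : ℝ) (h1 : -(π / 2) < x) (h2 : x < π / 2) :
    ((circleMap 0 1 (2 * x) - 1) / (Complex.log (1 + circleMap 0 1 (2 * x)) - a)).re =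
      ((cos (2 * x) - 1) * (Real.log (2 * Real.exp (-a) * Real.cos x)) + x * sin (2 * x)) /
        (x ^ 2 + Real.log (2 * Real.exp (-a) * Real.cos x) ^ 2) := by
  have hc : 0 < cos x := Real.cos_pos_of_mem_Ioo ⟨h1, h2⟩
  rw [aux_clog x h1 h2, aux_log_eq a x hc]
  have e : (((Real.log (cos x) + Real.log 2 : ℝ) : ℂ) + x * Complex.I) - a =
    ((Real.log (cos x) + (Real.log 2 - a) : ℝ) : ℂ) + x * Complex.I := by push_cast; ring
  rw [e]
  set L := Real.log (cos x) + (Real.log 2 - a)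
  rw [Complex.div_re, circleMap_zero]
  have e2 : Complex.exp (((2 * x : ℝ) : ℂ) * Complex.I) = (cos (2 * x) : ℝ) + (sin (2 * x) : ℝ) * Complex.I := by
    rw [Complex.exp_mul_I]; push_cast; rfl
  rw [e2]
  simp [Complex.normSq_apply, -Complex.ofReal_cos, -Complex.ofReal_sin, -Complex.ofReal_mul]
  rw [← add_div]
  congr 1 <;> ring

lemma aux_ne (x : ℝ) (h1 : -(π / 2) < x) (h2 : x < π / 2) :
    circleMap 0 1 (2 * x) ≠ -1 := by
  intro h
  have := congrArg Complex.re h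
  rw [circleMap_zero, Complex.exp_mul_I, ← Complex.ofReal_cos, ← Complex.ofReal_sin] at this
  simp [-Complex.ofReal_cos, -Complex.ofReal_sin, -Complex.ofReal_mul] at this
  have hc : 0 < cos x := Real.cos_pos_of_mem_Ioo ⟨h1, h2⟩
  rw [Real.cos_two_mul] at this
  nlinarith

lemma aux_ne1 (x : ℝ) (h0 : sin x ≠ 0) :
    circleMap 0 1 (2 * x) ≠ 1 := by
  intro h
  have := congrArg Complex.re h
  rw [circleMap_zero, Complex.exp_mul_I, ← Complex.ofReal_cos, ← Complex.ofReal_sin] at this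
  simp [-Complex.ofReal_cos, -Complex.ofReal_sin, -Complex.ofReal_mul] at this
  rw [Real.cos_two_mul, Real.cos_sq'] at this
  have : 0 < sin x ^ 2 := by positivity
  nlinarith

lemma aux_main (a A : ℝ) (R : ℂ → ℂ) (hR : ContinuousOn R (Metric.sphere 0 1))
    (h : ∀ z ∈ Metric.sphere (0:ℂ) 1, z ≠ -1 → z ≠ 1 → R z = (z - 1) / (Complex.log (1 + z) - a))
    (hA : circleAverage R 0 1 = (A : ℂ)) :
    ∫ x in (0:ℝ)..(π/2),
        Real.log (x ^ 2 + Real.log (2 * Real.exp (-a) * Real.cos x) ^ 2) *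
          Real.cos (2 * x) = - (π / 2) * A := by
  have hpi := Real.pi_pos
  have hm : ∀ t, circleMap 0 1 t ∈ Metric.sphere (0:ℂ) 1 := fun t => circleMap_mem_sphere 0 zero_le_one t
  have hRc : Continuous (fun t : ℝ => R (circleMap 0 1 t)) :=
    hR.comp_continuous (continuous_circleMap 0 1) hm
  set r : ℝ → ℝ := fun x => (R (circleMap 0 1 (2 * x))).re with hrdef
  have hr : Continuous r := Complex.continuous_re.comp (hRc.comp (by fun_prop : Continuous fun x : ℝ => 2 * x))
  have hper : ∀ x, r (π - x) = r (-x) := by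
    intro x
    simp only [hrdef]
    have : 2 * (π - x) = 2 * (-x) + 2 * π := by ring
    rw [this, periodic_circleMap]
  have hs : ∀ x ∈ Set.Ioo 0 (π / 2), r x =
      ((cos (2 * x) - 1) * (Real.log (2 * Real.exp (-a) * Real.cos x)) + x * sin (2 * x)) /
        (x ^ 2 + Real.log (2 * Real.exp (-a) * Real.cos x) ^ 2) := by
    intro x hx
    have hsin := Real.sin_pos_of_pos_of_lt_pi hx.1 (by linarith [hx.2])
    simp only [hrdef]
    rw [h _ (hm _) (aux_ne x (by linarith [hx.1]) hx.2) (aux_ne1 x hsin.ne'), aux_re a x (by linarith [hx.1]) hx.2]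
  have hs2 : ∀ x ∈ Set.Ioo 0 (π / 2), r (-x) = r x := by
    intro x hx
    have hsin := Real.sin_pos_of_pos_of_lt_pi hx.1 (by linarith [hx.2])
    rw [hs x hx]
    simp only [hrdef]
    rw [h _ (hm _) (aux_ne (-x) (by linarith [hx.2]) (by linarith [hx.1])) (aux_ne1 (-x) (by simpa using hsin.ne')),
      aux_re a (-x) (by linarith [hx.2]) (by linarith [hx.1])]
    simp
  rw [aux_parts a r hr hs]
  have i1 : ∫ x in (0:ℝ)..π, r x = π * A := by
    have : ∫ x in (0:ℝ)..π, r x = 2⁻¹ * ∫ t in (0:ℝ)..(2 * π), (R (circleMap 0 1 t)).re := by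
      have := intervalIntegral.integral_comp_mul_left (a := 0) (b := π) (fun t => (R (circleMap 0 1 t)).re) (two_ne_zero' ℝ)
      simpa [hrdef] using this
    rw [this]
    have h2 : ∫ t in (0:ℝ)..(2 * π), (R (circleMap 0 1 t)).re = (∫ t in (0:ℝ)..(2 * π), R (circleMap 0 1 t)).re := by
      have := Complex.reCLM.intervalIntegral_comp_comm (hRc.intervalIntegrable (μ := MeasureTheory.volume) 0 (2 * π))
      simpa using this
    rw [h2]
    rw [circleAverage_def] at hA
    have h3 := congrArg Complex.re hA
    rw [Complex.smul_re, Complex.ofReal_re, smul_eq_mul] at h3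
    rw [← h3]
    field_simp
  have i2 : ∫ x in (π / 2)..π, r x = ∫ x in (0:ℝ)..(π/2), r x := by
    have := intervalIntegral.integral_comp_sub_left (a := 0) (b := π / 2) r π
    rw [show π - π / 2 = π / 2 by ring, sub_zero] at this
    rw [← this]
    apply intervalIntegral.integral_congr_Ioo_of_le (by positivity)
    intro x hx
    simp only [hper, hs2 x hx]
  have i3 := intervalIntegral.integral_add_adjacent_intervals (hr.intervalIntegrable (μ := MeasureTheory.volume) 0 (π / 2))
    (hr.intervalIntegrable (μ := MeasureTheory.volume) (π / 2) π)
  linarith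

lemma aux_tendsto (a : ℝ) : Filter.Tendsto (fun z : ℂ => (Complex.log (1 + z) - a)⁻¹)
    (nhdsWithin (-1) {-1}ᶜ) (nhds 0) := by
  apply Filter.tendsto_inv₀_cobounded.comp
  rw [← tendsto_norm_atTop_iff_cobounded]
  have h1 : Filter.Tendsto (fun z : ℂ => ‖1 + z‖) (nhdsWithin (-1) {-1}ᶜ) (nhdsWithin 0 {0}ᶜ) := by
    apply tendsto_nhdsWithin_of_tendsto_nhds_of_eventually_within
    · have : ContinuousAt (fun z : ℂ => ‖1 + z‖) (-1) := by fun_prop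
      have h := this.tendsto
      simp only [add_neg_cancel, norm_zero] at h
      exact h.mono_left nhdsWithin_le_nhds
    · filter_upwards [self_mem_nhdsWithin] with z hz
      simp only [Set.mem_compl_iff, Set.mem_singleton_iff, norm_eq_zero] at hz ⊢
      intro h; apply hz; linear_combination h
  have h2 := Real.tendsto_log_nhdsNE_zero.comp h1
  have h3 := Filter.tendsto_neg_atBot_atTop.comp (Filter.tendsto_atBot_add_const_right _ (-a) h2)
  refine Filter.tendsto_atTop_mono ?_ h3
  intro z
  have := Complex.abs_re_le_norm (Complex.log (1 + z) - a)
  rw [Complex.sub_re, Complex.log_re, Complex.ofReal_re] at this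
  have h4 := neg_le_abs (Real.log ‖1 + z‖ - a)
  simp only [Function.comp]
  linarith

lemma aux_slit (z : ℂ) (hz : z ∈ Metric.closedBall (0:ℂ) 1) (h : z ≠ -1) :
    1 + z ∈ Complex.slitPlane := by
  rw [Complex.mem_slitPlane_iff]
  by_contra! hc
  obtain ⟨h1, h2⟩ := hc
  simp at h1 h2
  have h3 := Complex.abs_re_le_norm z
  have h4 : ‖z‖ ≤ 1 := by simpa using hz
  have h5 := neg_le_abs z.re
  apply h
  apply Complex.ext
  · simp; linarith
  · simpa using h2

lemma aux_zero (a : ℝ) (z : ℂ) (hz : z ≠ -1) (h : Complex.log (1 + z) - a = 0) :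
    z = ((Real.exp a - 1 : ℝ) : ℂ) := by
  have h1 : 1 + z ≠ 0 := by
    intro h'; apply hz; linear_combination h'
  have h2 := Complex.exp_log h1
  rw [sub_eq_zero.mp h] at h2
  push_cast
  rw [h2]; ring

lemma aux_caseA (a : ℝ) (ha : Real.log 2 < a) :
    ∫ x in (0:ℝ)..(π/2),
        Real.log (x ^ 2 + Real.log (2 * Real.exp (-a) * Real.cos x) ^ 2) *
          Real.cos (2 * x) = - (π / 2) * (1 / a) := by
  set g : ℂ → ℂ := fun z => (z - 1) * (Complex.log (1 + z) - a)⁻¹ with hg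
  have hd : ∀ z ∈ Metric.closedBall (0:ℂ) 1, z ≠ -1 → DifferentiableAt ℂ g z := by
    intro z hz hz1
    have hne : Complex.log (1 + z) - a ≠ 0 := by
      intro h
      have h1 := aux_zero a z hz1 h
      have h2 : ‖z‖ ≤ 1 := by simpa using hz
      rw [h1, Complex.norm_real, Real.norm_eq_abs] at h2
      have h3 := (Real.log_lt_iff_lt_exp two_pos).mp ha
      have := le_abs_self (Real.exp a - 1)
      linarith
    have := aux_slit z hz hz1
    have h2 : DifferentiableAt ℂ (fun z => Complex.log (1 + z)) z :=
      DifferentiableAt.clog (by fun_prop) this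
    exact DifferentiableAt.mul (by fun_prop) (DifferentiableAt.inv (by fun_prop) hne)
  have hG : ContinuousOn (Function.update g (-1) 0) (Metric.closedBall (0:ℂ) 1) := by
    intro z hz
    apply ContinuousAt.continuousWithinAt
    by_cases hz1 : z = -1
    · rw [hz1, continuousAt_update_same]
      have h1 : Filter.Tendsto (fun z : ℂ => z - 1) (nhdsWithin (-1) {-1}ᶜ) (nhds (-1 - 1)) :=
        (by fun_prop : ContinuousAt (fun z : ℂ => z - 1) (-1)).tendsto.mono_left nhdsWithin_le_nhds
      simpa using h1.mul (aux_tendsto a)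
    · rw [continuousAt_update_of_ne hz1]
      exact (hd z hz hz1).continuousAt
  refine aux_main a _ (Function.update g (-1) 0) (hG.mono Metric.sphere_subset_closedBall) ?_ ?_
  · intro z hz hz1 _
    rw [Function.update_of_ne hz1, hg, div_eq_mul_inv]
  · rw [circleAverage_of_differentiable_on_off_countable (s := ∅) (by simp) (by simpa using hG)]
    · rw [Function.update_of_ne (by simp)]
      simp [hg]
    · intro z hz
      have hz' : z ∈ Metric.ball (0:ℂ) 1 := by simpa using hz
      have hz1 : z ≠ -1 := by
        rintro rfl; simp at hz'
      have hev : Function.update g (-1) 0 =ᶠ[nhds z] g := by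
        filter_upwards [isOpen_ne.mem_nhds hz1] with w hw
        rw [Function.update_of_ne hw]
      exact (hd z (Metric.ball_subset_closedBall hz') hz1).congr_of_eventuallyEq hev

/-- the quotient `(z - z0) / (log (1+z) - a)`, extended continuously. -/
noncomputable def auxQ (a : ℝ) : ℂ → ℂ :=
  Function.update (fun z => (dslope (fun w => Complex.log (1 + w) - a) ((Real.exp a - 1 : ℝ) : ℂ) z)⁻¹) (-1) 0

lemma aux_f0 (a : ℝ) : Complex.log (1 + ((Real.exp a - 1 : ℝ) : ℂ)) - a = 0 := by
  have : 1 + ((Real.exp a - 1 : ℝ) : ℂ) = ((Real.exp a : ℝ) : ℂ) := by push_cast; ring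
  rw [this, ← Complex.ofReal_log (Real.exp_pos a).le, Real.log_exp, sub_self]

lemma aux_z0ne (a : ℝ) : ((Real.exp a - 1 : ℝ) : ℂ) ≠ -1 := by
  intro h
  have := congrArg Complex.re h
  simp [-Complex.ofReal_sub, -Complex.ofReal_exp] at this

lemma auxQ_of_ne (a : ℝ) (z : ℂ) (h1 : z ≠ -1) (h2 : z ≠ ((Real.exp a - 1 : ℝ) : ℂ)) :
    auxQ a z = (z - ((Real.exp a - 1 : ℝ) : ℂ)) * (Complex.log (1 + z) - a)⁻¹ := by
  unfold auxQ
  rw [Function.update_of_ne h1, dslope_of_ne _ h2, slope_def_field, aux_f0, sub_zero, inv_div, div_eq_mul_inv]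

lemma auxQ_diff (a : ℝ) (z : ℂ) (hz : z ∈ Metric.closedBall (0:ℂ) 1) (h1 : z ≠ -1)
    (h2 : z ≠ ((Real.exp a - 1 : ℝ) : ℂ)) : DifferentiableAt ℂ (auxQ a) z := by
  have hev : auxQ a =ᶠ[nhds z] fun z => (z - ((Real.exp a - 1 : ℝ) : ℂ)) * (Complex.log (1 + z) - a)⁻¹ := by
    filter_upwards [isOpen_ne.mem_nhds h1, isOpen_ne.mem_nhds h2] with w hw hw2
    exact auxQ_of_ne a w hw hw2
  refine DifferentiableAt.congr_of_eventuallyEq ?_ hev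
  have h3 : DifferentiableAt ℂ (fun z => Complex.log (1 + z)) z :=
    DifferentiableAt.clog (by fun_prop) (aux_slit z hz h1)
  exact DifferentiableAt.mul (by fun_prop) (DifferentiableAt.inv (by fun_prop)
    (fun h => h2 (aux_zero a z h1 h)))

lemma aux_deriv (a : ℝ) : HasDerivAt (fun w : ℂ => Complex.log (1 + w) - a) ((Real.exp a : ℝ) : ℂ)⁻¹
    ((Real.exp a - 1 : ℝ) : ℂ) := by
  have e : 1 + ((Real.exp a - 1 : ℝ) : ℂ) = ((Real.exp a : ℝ) : ℂ) := by push_cast; ring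
  have h1 : HasDerivAt (fun w : ℂ => 1 + w) 1 ((Real.exp a - 1 : ℝ) : ℂ) :=
    (hasDerivAt_id _).const_add 1
  have h2 := (h1.clog (by rw [e, Complex.ofReal_mem_slitPlane]; exact Real.exp_pos a)).sub_const (a : ℂ)
  rw [e] at h2
  simpa using h2

lemma auxQ_self (a : ℝ) : auxQ a ((Real.exp a - 1 : ℝ) : ℂ) = ((Real.exp a : ℝ) : ℂ) := by
  unfold auxQ
  rw [Function.update_of_ne (aux_z0ne a), dslope_same, (aux_deriv a).deriv, inv_inv]

lemma auxQ_cont (a : ℝ) : ContinuousOn (auxQ a) (Metric.closedBall (0:ℂ) 1) := by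
  intro z hz
  apply ContinuousAt.continuousWithinAt
  by_cases h1 : z = -1
  · subst h1
    unfold auxQ
    rw [continuousAt_update_same]
    have h1 : Filter.Tendsto (fun z : ℂ => z - ((Real.exp a - 1 : ℝ) : ℂ)) (nhdsWithin (-1) {-1}ᶜ)
        (nhds (-1 - ((Real.exp a - 1 : ℝ) : ℂ))) :=
      (by fun_prop : ContinuousAt (fun z : ℂ => z - ((Real.exp a - 1 : ℝ) : ℂ)) (-1)).tendsto.mono_left nhdsWithin_le_nhds
    have h2 := h1.mul (aux_tendsto a)
    rw [mul_zero] at h2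
    refine h2.congr' ?_
    filter_upwards [self_mem_nhdsWithin, nhdsWithin_le_nhds (isOpen_ne.mem_nhds (aux_z0ne a).symm)] with w hw hw2
    rw [← auxQ_of_ne a w hw hw2]
    unfold auxQ
    rw [Function.update_of_ne hw]
  by_cases h2 : z = ((Real.exp a - 1 : ℝ) : ℂ)
  · unfold auxQ
    rw [continuousAt_update_of_ne h1, h2]
    refine ContinuousAt.inv₀ (continuousAt_dslope_same.mpr (aux_deriv a).differentiableAt) ?_
    rw [dslope_same, (aux_deriv a).deriv]
    simp
  · exact (auxQ_diff a z hz h1 h2).continuousAt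

lemma aux_caseB (a : ℝ) (ha : a = Real.log 2) :
    ∫ x in (0:ℝ)..(π/2),
        Real.log (x ^ 2 + Real.log (2 * Real.exp (-a) * Real.cos x) ^ 2) *
          Real.cos (2 * x) = - (π / 2) * (1 / a) := by
  have e : ((Real.exp a - 1 : ℝ) : ℂ) = 1 := by
    rw [ha, Real.exp_log two_pos]; norm_num
  refine aux_main a _ (auxQ a) ((auxQ_cont a).mono Metric.sphere_subset_closedBall) ?_ ?_
  · intro z hz hz1 hz2
    rw [auxQ_of_ne a z hz1 (by rwa [e]), e, div_eq_mul_inv]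
  · rw [circleAverage_of_differentiable_on_off_countable (s := ∅) (by simp) (by simpa using auxQ_cont a)]
    · rw [auxQ_of_ne a 0 (by simp) (by rw [e]; simp), e]
      simp
    · intro z hz
      have hz' : z ∈ Metric.ball (0:ℂ) 1 := by simpa using hz
      refine auxQ_diff a z (Metric.ball_subset_closedBall hz') ?_ ?_
      · rintro rfl; simp at hz'
      · rw [e]; rintro rfl; simp at hz'

lemma aux_caseC (a : ℝ) (ha0 : a ≠ 0) (ha : a < Real.log 2) :
    ∫ x in (0:ℝ)..(π/2),
        Real.log (x ^ 2 + Real.log (2 * Real.exp (-a) * Real.cos x) ^ 2) *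
          Real.cos (2 * x) = - (π / 2) * (1 / a + (Real.exp a - 1) - 1 / (Real.exp a - 1)) := by
  have hexp := Real.exp_pos a
  have hexp2 : Real.exp a < 2 := (Real.lt_log_iff_exp_lt two_pos).mp ha
  obtain ⟨z0, hz0⟩ : ∃ z0 : ℂ, z0 = ((Real.exp a - 1 : ℝ) : ℂ) := ⟨_, rfl⟩
  have hz00 : z0 ≠ 0 := by
    rw [hz0, Ne, Complex.ofReal_eq_zero, sub_eq_zero, Real.exp_eq_one_iff]; exact ha0
  have hball : z0 ∈ Metric.ball (0:ℂ) 1 := by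
    rw [mem_ball_zero_iff, hz0, Complex.norm_real, Real.norm_eq_abs, abs_lt]
    constructor <;> linarith
  have hnorm : ‖z0‖ < 1 := by simpa using hball
  have hsph : ∀ z ∈ Metric.sphere (0:ℂ) 1, z ≠ z0 := by
    rintro z hz rfl
    rw [mem_sphere_zero_iff_norm] at hz
    linarith
  set G : ℂ → ℂ := fun z => (z - 1) * auxQ a z with hG
  have hGc : ContinuousOn G (Metric.closedBall (0:ℂ) 1) :=
    ContinuousOn.mul (by fun_prop) (auxQ_cont a)
  have hGd : ∀ z ∈ Metric.ball (0:ℂ) 1 \ {z0}, DifferentiableAt ℂ G z := by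
    intro z hz
    refine DifferentiableAt.mul (by fun_prop) (auxQ_diff a z (Metric.ball_subset_closedBall hz.1) ?_ ?_)
    · rintro rfl; simp at hz
    · rw [← hz0]; exact hz.2
  have c1 := Complex.circleIntegral_sub_inv_smul_of_differentiable_on_off_countable
    (Set.countable_singleton z0) hball hGc hGd
  have c2 := Complex.circleIntegral_sub_inv_smul_of_differentiable_on_off_countable
    (Set.countable_singleton z0) (w := 0) (by simp) hGc hGd
  have hGs : ContinuousOn G (Metric.sphere (0:ℂ) 1) := hGc.mono Metric.sphere_subset_closedBall
  have hi : ∀ w ∉ Metric.sphere (0:ℂ) 1, CircleIntegrable (fun z => (z - w)⁻¹ • G z) 0 1 := by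
    intro w hw
    apply ContinuousOn.circleIntegrable zero_le_one
    have hsub : ContinuousOn (fun z : ℂ => z - w) (Metric.sphere (0:ℂ) 1) := by fun_prop
    refine ContinuousOn.smul (ContinuousOn.inv₀ hsub ?_) hGs
    intro z hz h
    rw [sub_eq_zero.mp h] at hz
    exact hw hz
  refine aux_main a _ (fun z => G z * (z - z0)⁻¹) ?_ ?_ ?_
  · refine ContinuousOn.mul hGs (ContinuousOn.inv₀ (by fun_prop) ?_)
    intro z hz
    exact sub_ne_zero.mpr (hsph z hz)
  · intro z hz hz1 _
    have hne := sub_ne_zero.mpr (hsph z hz)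
    simp only [hG]
    rw [auxQ_of_ne a z hz1 (by rw [← hz0]; exact hsph z hz), ← hz0, div_eq_mul_inv]
    field_simp
  · rw [circleAverage_eq_circleIntegral one_ne_zero]
    have e : (∮ z in C(0, 1), (z - 0)⁻¹ • (G z * (z - z0)⁻¹)) =
        ∮ z in C(0, 1), z0⁻¹ • ((z - z0)⁻¹ • G z - (z - 0)⁻¹ • G z) := by
      apply circleIntegral.integral_congr zero_le_one
      intro z hz
      have hne := sub_ne_zero.mpr (hsph z hz)
      have hne0 : z ≠ 0 := by rintro rfl; simp at hz
      simp only [smul_eq_mul, sub_zero]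
      field_simp
      ring
    rw [e, circleIntegral.integral_smul, circleIntegral.integral_sub (hi _ ?_) (hi _ (by simp)), c1, c2]
    · simp only [hG]
      have q1 : auxQ a z0 = 1 + z0 := by
        rw [hz0, auxQ_self]; push_cast; ring
      have q2 : auxQ a 0 = z0 / a := by
        rw [auxQ_of_ne a 0 (by simp) (by rw [← hz0]; exact hz00.symm), ← hz0]
        simp
        rw [div_eq_mul_inv]
      rw [q1, q2]
      have hA : (((1 / a + (Real.exp a - 1) - 1 / (Real.exp a - 1)) : ℝ) : ℂ) = 1 / a + z0 - 1 / z0 := by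
        rw [hz0]; push_cast; ring
      rw [hA]
      have ha' : (a : ℂ) ≠ 0 := by exact_mod_cast ha0
      have hpi : (π : ℂ) ≠ 0 := by exact_mod_cast Real.pi_ne_zero
      simp only [smul_eq_mul]
      field_simp
      ring
    · intro h
      exact hsph z0 h rfl

/-- For nonzero real `a`, with `b = min(a, ln 2)`,
`∫_0^{π/2} ln(x² + ln²(2 e^{-a} cos x)) cos 2x dx
  = (π/2)(1 − 1/a − e^b + 1/(e^b − 1))`. -/
theorem integral_log_sq_add_log_sq_shifted_cos (a : ℝ) (ha : a ≠ 0)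
    (b : ℝ) (hb : b = min a (Real.log 2)) :
    ∫ x in (0:ℝ)..(π/2),
        Real.log (x ^ 2 + Real.log (2 * Real.exp (-a) * Real.cos x) ^ 2) *
          Real.cos (2 * x)
    = (π / 2) * (1 - 1 / a - Real.exp b + 1 / (Real.exp b - 1)) := by
  rcases lt_trichotomy a (Real.log 2) with h | h | h
  · rw [hb, min_eq_left h.le, aux_caseC a ha h]
    ring
  · rw [hb, min_eq_right h.ge, aux_caseB a h, Real.exp_log two_pos]
    ring
  · rw [hb, min_eq_right h.le, aux_caseA a h, Real.exp_log two_pos]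
    ring
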